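/- Let R ∈ ℕ, λ, k₁, k₂ ∈ ℝ, δ₀, …, δ_R ∈ ℝ, and c ∈ ℝ. For y > 0 define h(y) := λ·y − k₁/y³ − k₂/y² − Σ_{n=0}^{R} δₙ·y^{2n+1} and Q(y) := c − 2·λ·y² − 2·k₁/y² − 4·k₂/y + Σ_{n=0}^{R} (2·δₙ/(n+1))·y^{2n+2}. Let J ⊆ (0,∞) be an open interval on which Q(y) > 0, and define g(y) := h(y)/√(Q(y)). Let I ⊆ ℝ be an open interval and Y : I → J differentiable with Y'(t) = √(Q(Y(t))) for all t ∈ I. Then Y is twice differentiable and satisfies the generalized damped Milne–Pinney equation Y''(t) + g(Y(t))·Y'(t) + λ·Y(t) = k₁/Y(t)³ + k₂/Y(t)² + Σ_{n=0}^{R} δₙ·Y(t)^{2n+1} for all t ∈ I. -/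

import Mathlib

open Set

/-- The derivative of `c − 2λy² − 2k₁/y² − 4k₂/y + Σₙ (2δₙ/(n+1)) y^(2n+2)` is
`−4 (λy − k₁/y³ − k₂/y² − Σₙ δₙ y^(2n+1))`. -/
theorem hasDerivAt_milnePinney_radicand (R : ℕ) (lam k₁ k₂ c : ℝ) (dlt : ℕ → ℝ) {y : ℝ}
    (hy : y ≠ 0) :
    HasDerivAt (fun y : ℝ => c - 2 * lam * y ^ 2 - 2 * k₁ / y ^ 2 - 4 * k₂ / y
        + ∑ n ∈ Finset.range (R + 1), (2 * dlt n / ((n : ℝ) + 1)) * y ^ (2 * n + 2))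
      (-4 * (lam * y - k₁ / y ^ 3 - k₂ / y ^ 2
        - ∑ n ∈ Finset.range (R + 1), dlt n * y ^ (2 * n + 1))) y := by
  have hsum : HasDerivAt
      (fun y : ℝ => ∑ n ∈ Finset.range (R + 1), (2 * dlt n / ((n : ℝ) + 1)) * y ^ (2 * n + 2))
      (∑ n ∈ Finset.range (R + 1), 4 * (dlt n * y ^ (2 * n + 1))) y := by
    refine HasDerivAt.fun_sum fun n _ => ?_
    refine ((hasDerivAt_pow (2 * n + 2) y).const_mul _).congr_deriv ?_
    have hn : (n : ℝ) + 1 ≠ 0 := n.cast_add_one_ne_zero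
    rw [show 2 * n + 2 - 1 = 2 * n + 1 by omega]
    push_cast
    field_simp
    ring
  have hsq := hasDerivAt_pow 2 y
  refine (((((hasDerivAt_const y c).sub (hsq.const_mul (2 * lam))).sub
    ((hasDerivAt_const y (2 * k₁)).div hsq (pow_ne_zero 2 hy))).sub
    ((hasDerivAt_const y (4 * k₂)).div (hasDerivAt_id y) hy)).add hsum).congr_deriv ?_
  rw [← Finset.mul_sum]
  simp only [id]
  field_simp
  ring

/-- A solution of `Y' = √(Q(Y))` is twice differentiable wherever `Q(Y)` is positive, with
`Y'' = Q'(Y) / 2`. -/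
theorem hasDerivAt_deriv_of_eventually_hasDerivAt_sqrt {Q Y : ℝ → ℝ} {q t : ℝ}
    (hY : ∀ᶠ s in nhds t, HasDerivAt Y (Real.sqrt (Q (Y s))) s)
    (hQ : HasDerivAt Q q (Y t)) (hpos : 0 < Q (Y t)) :
    HasDerivAt (deriv Y) (q / 2) t := by
  have hsqrt : HasDerivAt (fun s => Real.sqrt (Q (Y s))) (q / 2) t := by
    refine ((hQ.comp t hY.self_of_nhds).sqrt hpos.ne').congr_deriv ?_
    have : Real.sqrt (Q (Y t)) ≠ 0 := (Real.sqrt_pos.2 hpos).ne'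
    simp only [Function.comp_apply]
    field_simp
  exact hsqrt.congr_of_eventuallyEq (hY.mono fun s hs => hs.deriv)

/-- The generalized damped Milne–Pinney equation with arbitrary `R`:
with `h(y) = λy − k₁/y³ − k₂/y² − Σₙ δₙ y^(2n+1)`,
`Q(y) = c − 2λy² − 2k₁/y² − 4k₂/y + Σₙ (2δₙ/(n+1)) y^(2n+2)` positive on an open interval
`J ⊆ (0,∞)`, and `g = h/√Q`, any solution of `Y' = √(Q(Y))` with values in `J` is twice
differentiable and satisfies `Y'' + g(Y)·Y' + λY = k₁/Y³ + k₂/Y² + Σₙ δₙ Y^(2n+1)`. -/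
theorem generalized_damped_milne_pinney
    (R : ℕ) (lam k₁ k₂ c : ℝ) (dlt : ℕ → ℝ) (aJ bJ aI bI : ℝ)
    (h Q g Y : ℝ → ℝ)
    (hhdef : ∀ y : ℝ, 0 < y → h y =
      lam * y - k₁ / y ^ 3 - k₂ / y ^ 2
        - ∑ n ∈ Finset.range (R + 1), dlt n * y ^ (2 * n + 1))
    (hQdef : ∀ y : ℝ, 0 < y → Q y =
      c - 2 * lam * y ^ 2 - 2 * k₁ / y ^ 2 - 4 * k₂ / y
        + ∑ n ∈ Finset.range (R + 1), (2 * dlt n / ((n : ℝ) + 1)) * y ^ (2 * n + 2))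
    (hJpos : ∀ y ∈ Ioo aJ bJ, 0 < y)
    (hQpos : ∀ y ∈ Ioo aJ bJ, 0 < Q y)
    (hgdef : ∀ y ∈ Ioo aJ bJ, g y = h y / Real.sqrt (Q y))
    (hYmem : ∀ t ∈ Ioo aI bI, Y t ∈ Ioo aJ bJ)
    (hY : ∀ t ∈ Ioo aI bI, HasDerivAt Y (Real.sqrt (Q (Y t))) t) :
    ∀ t ∈ Ioo aI bI,
      DifferentiableAt ℝ (deriv Y) t ∧
      deriv (deriv Y) t + g (Y t) * deriv Y t + lam * Y t
        = k₁ / (Y t) ^ 3 + k₂ / (Y t) ^ 2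
          + ∑ n ∈ Finset.range (R + 1), dlt n * (Y t) ^ (2 * n + 1) := by
  intro t ht
  have hYJ := hYmem t ht
  have hYpos : 0 < Y t := hJpos _ hYJ
  have hQY := hQpos _ hYJ
  have hQ' : HasDerivAt Q (-4 * h (Y t)) (Y t) := by
    rw [hhdef _ hYpos]
    exact (hasDerivAt_milnePinney_radicand R lam k₁ k₂ c dlt hYpos.ne').congr_of_eventuallyEq
      ((eventually_gt_nhds hYpos).mono hQdef)
  have hY'' : HasDerivAt (deriv Y) (-4 * h (Y t) / 2) t :=
    hasDerivAt_deriv_of_eventually_hasDerivAt_sqrt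
      (Filter.eventually_of_mem (isOpen_Ioo.mem_nhds ht) hY) hQ' hQY
  refine ⟨hY''.differentiableAt, ?_⟩
  rw [hY''.deriv, (hY t ht).deriv, hgdef _ hYJ, div_mul_cancel₀ _ (Real.sqrt_pos.2 hQY).ne',
    hhdef _ hYpos]
  ring
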